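/- Let 1 < q < ∞ and let ω_ν : [0,T'] → L^q(Ω) be a family of continuous maps (ν > 0) and ω : [0,T'] → L^q(Ω) continuous. Assume: (a) for every φ ∈ L^{q'}(Ω), ∫ φ ω_ν(t) → ∫ φ ω(t) uniformly in t ∈ [0,T']; (b) ‖ω_ν(t)‖_{L^q} → ‖ω(t)‖_{L^q} uniformly in t ∈ [0,T']. Then sup_{t∈[0,T']} ‖ω_ν(t) − ω(t)‖_{L^q} → 0. -/

import Mathlib

open MeasureTheory Filter Set Topology ENNReal

lemma aux_gap_nonneg {p : ℝ} (hp : 1 < p) (a b : ℝ) (hab : a ≠ b) :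
    0 < (|a| ^ p + |b| ^ p) / 2 - |(a + b) / 2| ^ p := by
  have hp0 : 0 < p := by linarith
  by_cases h : |a| = |b|
  · have hb : b = -a := by
      rcases abs_eq_abs.1 h with h | h
      · exact absurd h hab
      · linarith
    have ha : a ≠ 0 := by
      rintro rfl
      apply hab; rw [hb]; simp
    have : 0 < |a| ^ p := Real.rpow_pos_of_pos (abs_pos.2 ha) _
    rw [← h, hb]
    simp only [add_neg_cancel, zero_div, abs_zero]
    rw [Real.zero_rpow hp0.ne']
    linarith
  · have h1 := (strictConvexOn_rpow hp).2 (mem_Ici.2 (abs_nonneg a)) (mem_Ici.2 (abs_nonneg b)) h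
      (show (0:ℝ) < 1/2 by norm_num) (show (0:ℝ) < 1/2 by norm_num) (by norm_num)
    simp only [smul_eq_mul] at h1
    have h2 : |(a + b) / 2| ^ p ≤ (1/2 * |a| + 1/2 * |b|) ^ p := by
      apply Real.rpow_le_rpow (abs_nonneg _) _ hp0.le
      rw [abs_div, abs_of_pos (by norm_num : (0:ℝ) < 2)]
      linarith [abs_add_le a b]
    linarith

lemma aux_pointwise {p : ℝ} (hp : 1 < p) {ε : ℝ} (hε : 0 < ε) :
    ∃ C : ℝ, 0 ≤ C ∧ ∀ a b : ℝ, |a - b| ^ p ≤ ε * (|a| ^ p + |b| ^ p)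
      + C * ((|a| ^ p + |b| ^ p) / 2 - |(a + b) / 2| ^ p) := by
  have hp0 : 0 < p := by linarith
  have hc : ∀ g : ℝ × ℝ → ℝ, Continuous g → Continuous fun x => |g x| ^ p := fun g hg =>
    (Real.continuous_rpow_const hp0.le).comp (continuous_abs.comp hg)
  set f : ℝ × ℝ → ℝ := fun x => |x.1 - x.2| ^ p - ε * (|x.1| ^ p + |x.2| ^ p) with hf
  set g : ℝ × ℝ → ℝ := fun x => (|x.1| ^ p + |x.2| ^ p) / 2 - |(x.1 + x.2) / 2| ^ p with hg
  have h1 := hc _ continuous_fst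
  have h2 := hc _ continuous_snd
  have h3 := hc (fun x => x.1 - x.2) (by fun_prop)
  have h4 := hc (fun x => (x.1 + x.2) / 2) (by fun_prop)
  have hfc : Continuous f := h3.sub (continuous_const.mul (h1.add h2))
  have hgc : Continuous g := ((h1.add h2).div_const 2).sub h4
  have hg0 : ∀ x, 0 ≤ g x := by
    rintro ⟨a, b⟩
    by_cases h : a = b
    · subst h; simp [hg]
    · exact (aux_gap_nonneg hp a b h).le
  have key : ∃ C : ℝ, 0 ≤ C ∧ ∀ x ∈ Metric.sphere (0 : ℝ × ℝ) 1, f x ≤ C * g x := by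
    have hK : IsCompact (Metric.sphere (0 : ℝ × ℝ) 1 ∩ {x | 0 ≤ f x}) :=
      (isCompact_sphere _ _).inter_right (isClosed_le continuous_const hfc)
    have hpos : ∀ x ∈ Metric.sphere (0 : ℝ × ℝ) 1 ∩ {x | 0 ≤ f x}, 0 < g x := by
      rintro ⟨a, b⟩ ⟨hx, hfx⟩
      apply aux_gap_nonneg hp a b
      rintro rfl
      have ha : a ≠ 0 := by
        rintro rfl
        simp at hx
      have : 0 < |a| ^ p := Real.rpow_pos_of_pos (abs_pos.2 ha) _
      simp only [hf, mem_ofPred_eq, sub_self, abs_zero, Real.zero_rpow hp0.ne'] at hfx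
      nlinarith
    obtain ⟨C, hC⟩ := hK.exists_bound_of_continuousOn (f := fun x => f x / g x)
      (hfc.continuousOn.div hgc.continuousOn fun x hx => (hpos x hx).ne')
    refine ⟨max C 0, le_max_right _ _, fun x hx => ?_⟩
    by_cases h : 0 ≤ f x
    · have := (le_abs_self _).trans ((hC x ⟨hx, h⟩).trans (le_max_left C 0))
      exact (div_le_iff₀ (hpos x ⟨hx, h⟩)).1 this
    · exact (not_le.1 h).le.trans (mul_nonneg (le_max_right _ _) (hg0 x))
  obtain ⟨C, hC0, hC⟩ := key
  refine ⟨C, hC0, fun a b => ?_⟩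
  by_cases h0 : ((a, b) : ℝ × ℝ) = 0
  · obtain ⟨rfl, rfl⟩ := Prod.mk.inj h0
    simp [Real.zero_rpow hp0.ne']
  set r := ‖((a, b) : ℝ × ℝ)‖ with hr
  have hr0 : 0 < r := norm_pos_iff.2 h0
  have hs : ∀ x : ℝ, |x| ^ p = r ^ p * |r⁻¹ * x| ^ p := fun x => by
    rw [← Real.mul_rpow hr0.le (abs_nonneg _), abs_mul, abs_of_pos (inv_pos.2 hr0),
      mul_inv_cancel_left₀ hr0.ne']
  have := hC (r⁻¹ • (a, b)) (by
    rw [mem_sphere_zero_iff_norm, norm_smul, norm_inv, norm_norm, inv_mul_cancel₀ hr0.ne'])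
  simp only [hf, hg, Prod.smul_mk, smul_eq_mul] at this
  have hrp : 0 < r ^ p := Real.rpow_pos_of_pos hr0 _
  rw [hs (a - b), hs a, hs b, hs ((a + b) / 2)]
  rw [show r⁻¹ * (a - b) = r⁻¹ * a - r⁻¹ * b by ring,
    show r⁻¹ * ((a + b) / 2) = (r⁻¹ * a + r⁻¹ * b) / 2 by ring]
  have := mul_le_mul_of_nonneg_left this hrp.le
  linarith

lemma aux_norm_rpow {α : Type*} [MeasurableSpace α] {μ : Measure α}
    {q : ℝ≥0∞} (hq1 : 1 < q) (hq2 : q ≠ ⊤) (x : Lp ℝ q μ) :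
    Integrable (fun s => |x s| ^ q.toReal) μ ∧ ‖x‖ ^ q.toReal = ∫ s, |x s| ^ q.toReal ∂μ := by
  have hq0 : q ≠ 0 := (zero_lt_one.trans hq1).ne'
  have hm := Lp.memLp x
  refine ⟨hm.integrable_norm_rpow hq0 hq2, ?_⟩
  have hnn : 0 ≤ ∫ s, ‖x s‖ ^ q.toReal ∂μ := integral_nonneg fun s => by positivity
  rw [Lp.norm_def, hm.eLpNorm_eq_integral_rpow_norm hq0 hq2,
    ENNReal.toReal_ofReal (by positivity), ← Real.rpow_mul hnn,
    inv_mul_cancel₀ (ENNReal.toReal_pos hq0 hq2).ne', Real.rpow_one]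
  rfl

lemma aux_Lp {α : Type*} [MeasurableSpace α] {μ : Measure α}
    {q : ℝ≥0∞} (hq1 : 1 < q) (hq2 : q ≠ ⊤) [Fact (1 ≤ q)] {ε : ℝ} (hε : 0 < ε) :
    ∃ C : ℝ, 0 ≤ C ∧ ∀ x y : Lp ℝ q μ, ‖x - y‖ ^ q.toReal ≤
      ε * (‖x‖ ^ q.toReal + ‖y‖ ^ q.toReal)
      + C * ((‖x‖ ^ q.toReal + ‖y‖ ^ q.toReal) / 2 - ‖(2⁻¹ : ℝ) • (x + y)‖ ^ q.toReal) := by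
  have hp : 1 < q.toReal := by
    rw [← ENNReal.toReal_one]; exact (ENNReal.toReal_lt_toReal one_ne_top hq2).2 hq1
  obtain ⟨C, hC0, hC⟩ := aux_pointwise hp hε
  refine ⟨C, hC0, fun x y => ?_⟩
  obtain ⟨ix, ex⟩ := aux_norm_rpow hq1 hq2 x
  obtain ⟨iy, ey⟩ := aux_norm_rpow hq1 hq2 y
  obtain ⟨id, ed⟩ := aux_norm_rpow hq1 hq2 (x - y)
  obtain ⟨im, em⟩ := aux_norm_rpow hq1 hq2 ((2⁻¹ : ℝ) • (x + y))
  have is : Integrable (fun s => |x s| ^ q.toReal + |y s| ^ q.toReal) μ := ix.add iy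
  have ig : Integrable (fun s => (|x s| ^ q.toReal + |y s| ^ q.toReal) / 2
      - |((2⁻¹ : ℝ) • (x + y) : Lp ℝ q μ) s| ^ q.toReal) μ := (is.div_const 2).sub im
  rw [ex, ey, ed, em, ← integral_add ix iy, ← integral_div,
    ← integral_sub (is.div_const 2) im, ← integral_const_mul, ← integral_const_mul,
    ← integral_add (is.const_mul ε) (ig.const_mul C)]
  refine integral_mono_ae id ((is.const_mul ε).add (ig.const_mul C)) ?_
  filter_upwards [Lp.coeFn_sub x y, Lp.coeFn_smul (2⁻¹ : ℝ) (x + y), Lp.coeFn_add x y]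
    with s h1 h2 h3
  have h4 : ((2⁻¹ : ℝ) • (x + y) : Lp ℝ q μ) s = (x s + y s) / 2 := by
    rw [h2, Pi.smul_apply, h3, Pi.add_apply, smul_eq_mul]; ring
  have h5 : (x - y : Lp ℝ q μ) s = x s - y s := h1
  simp only [h4, h5, Pi.add_apply, Pi.sub_apply]
  exact hC _ _

/-- Radon–Riesz property of `L^q`, along an arbitrary filter. -/
lemma aux_radon_riesz {α ι : Type*} [MeasurableSpace α] {μ : Measure α}
    {q : ℝ≥0∞} (hq1 : 1 < q) (hq2 : q ≠ ⊤) [Fact (1 ≤ q)] (l : Filter ι)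
    (u : ι → Lp ℝ q μ) (x : Lp ℝ q μ)
    (hw : ∀ L : Lp ℝ q μ →L[ℝ] ℝ, Tendsto (fun i => L (u i)) l (𝓝 (L x)))
    (hn : Tendsto (fun i => ‖u i‖) l (𝓝 ‖x‖)) : Tendsto u l (𝓝 x) := by
  have hp : 0 < q.toReal := ENNReal.toReal_pos (zero_lt_one.trans hq1).ne' hq2
  set p := q.toReal with hpdef
  obtain ⟨L, hL1, hLx⟩ := exists_dual_vector'' ℝ x
  have hLx' : L x = ‖x‖ := by simpa using hLx
  have hnp : Tendsto (fun i => ‖u i‖ ^ p) l (𝓝 (‖x‖ ^ p)) :=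
    hn.rpow_const (Or.inr hp.le)
  -- lower bound for the midpoint
  have hmid : Tendsto (fun i => |2⁻¹ * (L (u i) + ‖x‖)| ^ p) l (𝓝 (‖x‖ ^ p)) := by
    have h1 := (((hw L).add_const ‖x‖).const_mul (2⁻¹ : ℝ)).abs.rpow_const (p := p) (Or.inr hp.le)
    rw [hLx', show (2⁻¹ : ℝ) * (‖x‖ + ‖x‖) = ‖x‖ by ring, abs_norm] at h1
    exact h1
  have hmle : ∀ i, |2⁻¹ * (L (u i) + ‖x‖)| ^ p ≤ ‖(2⁻¹ : ℝ) • (u i + x)‖ ^ p := fun i => by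
    refine Real.rpow_le_rpow (abs_nonneg _) ?_ hp.le
    have := L.le_of_opNorm_le hL1 ((2⁻¹ : ℝ) • (u i + x))
    rwa [map_smul, map_add, hLx', smul_eq_mul, one_mul, Real.norm_eq_abs] at this
  have hd : Tendsto (fun i => ‖u i - x‖ ^ p) l (𝓝 0) := by
    rw [Metric.tendsto_nhds]
    intro η hη
    have hB : 0 < 2 * ‖x‖ ^ p + 1 := by positivity
    set ε := η / (2 * (2 * ‖x‖ ^ p + 1)) with hε
    obtain ⟨C, hC0, hC⟩ := aux_Lp (μ := μ) hq1 hq2 (show 0 < ε by positivity)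
    have ht : Tendsto (fun i => ε * (‖u i‖ ^ p + ‖x‖ ^ p)
        + C * ((‖u i‖ ^ p + ‖x‖ ^ p) / 2 - |2⁻¹ * (L (u i) + ‖x‖)| ^ p)) l
        (𝓝 (ε * (‖x‖ ^ p + ‖x‖ ^ p) + C * ((‖x‖ ^ p + ‖x‖ ^ p) / 2 - ‖x‖ ^ p))) :=
      ((hnp.add_const _).const_mul ε).add
        ((((hnp.add_const _).div_const 2).sub hmid).const_mul C)
    have hlt : ε * (‖x‖ ^ p + ‖x‖ ^ p) + C * ((‖x‖ ^ p + ‖x‖ ^ p) / 2 - ‖x‖ ^ p) < η := by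
      have : ε * (2 * ‖x‖ ^ p + 1) = η / 2 := by rw [hε]; field_simp
      have he : 0 < ε := by positivity
      rw [show (‖x‖ ^ p + ‖x‖ ^ p) / 2 - ‖x‖ ^ p = 0 by ring]
      nlinarith
    filter_upwards [ht.eventually_lt_const hlt] with i hi
    rw [Real.dist_eq, sub_zero, abs_of_nonneg (by positivity)]
    refine ((hC (u i) x).trans ?_).trans_lt hi
    have := mul_le_mul_of_nonneg_left (hmle i) hC0
    linarith
  rw [tendsto_iff_norm_sub_tendsto_zero]
  have := hd.rpow_const (p := p⁻¹) (Or.inr (inv_pos.2 hp).le)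
  rw [Real.zero_rpow (inv_pos.2 hp).ne'] at this
  refine this.congr fun i => ?_
  rw [← Real.rpow_mul (norm_nonneg _), mul_inv_cancel₀ hp.ne', Real.rpow_one]

/-- Uniform-in-time weak convergence plus uniform-in-time convergence of the
`L^q` norms implies uniform-in-time strong convergence, `1 < q < ∞`. -/
theorem stmt_5 {α : Type*} [MeasurableSpace α] (μ : Measure α) [SigmaFinite μ]
    (q : ℝ≥0∞) (hq1 : 1 < q) (hq2 : q ≠ ⊤) [Fact (1 ≤ q)] (T' : ℝ) (hT' : 0 < T')
    (ω : ℝ → ℝ → Lp ℝ q μ) (ωlim : ℝ → Lp ℝ q μ)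
    (hc : ∀ ν > (0:ℝ), ContinuousOn (ω ν) (Icc 0 T'))
    (hlc : ContinuousOn ωlim (Icc 0 T'))
    (hweak : ∀ L : Lp ℝ q μ →L[ℝ] ℝ,
      TendstoUniformlyOn (fun ν t => L (ω ν t)) (fun t => L (ωlim t)) (𝓝[>] (0:ℝ)) (Icc 0 T'))
    (hnorm : TendstoUniformlyOn (fun ν t => ‖ω ν t‖) (fun t => ‖ωlim t‖) (𝓝[>] (0:ℝ)) (Icc 0 T')) :
    TendstoUniformlyOn (fun ν t => ω ν t) ωlim (𝓝[>] (0:ℝ)) (Icc 0 T') := by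
  rw [tendstoUniformlyOn_iff_tendsto, tendsto_iff_ultrafilter]
  intro U hU
  have hmem : Tendsto (fun z : ℝ × ℝ => z.2) (U : Filter (ℝ × ℝ)) (𝓟 (Icc 0 T')) :=
    tendsto_snd.mono_left hU
  obtain ⟨t0, ht0, hle⟩ := isCompact_Icc.ultrafilter_le_nhds (U.map (fun z : ℝ × ℝ => z.2)) hmem
  have ht : Tendsto (fun z : ℝ × ℝ => z.2) (U : Filter (ℝ × ℝ)) (𝓝[Icc 0 T'] t0) :=
    le_inf hle hmem
  have hlim : Tendsto (fun z : ℝ × ℝ => ωlim z.2) (U : Filter (ℝ × ℝ)) (𝓝 (ωlim t0)) :=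
    (hlc t0 ht0).tendsto.comp ht
  have tr : ∀ (F : ℝ × ℝ → ℝ) (G : ℝ × ℝ → ℝ) (a : ℝ),
      Tendsto (fun z => (G z, F z)) (U : Filter (ℝ × ℝ)) (uniformity ℝ) →
      Tendsto G (U : Filter (ℝ × ℝ)) (𝓝 a) → Tendsto F (U : Filter (ℝ × ℝ)) (𝓝 a) := by
    intro F G a h1 h2
    exact h2.congr_uniformity h1
  have hs : Tendsto (fun z : ℝ × ℝ => ω z.1 z.2) (U : Filter (ℝ × ℝ)) (𝓝 (ωlim t0)) := by
    refine aux_radon_riesz hq1 hq2 _ _ _ (fun L => ?_) ?_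
    · exact tr _ (fun z => L (ωlim z.2)) _
        ((tendstoUniformlyOn_iff_tendsto.1 (hweak L)).mono_left hU)
        ((L.continuous.tendsto _).comp hlim)
    · exact tr _ (fun z => ‖ωlim z.2‖) _
        ((tendstoUniformlyOn_iff_tendsto.1 hnorm).mono_left hU) hlim.norm
  exact (hlim.prodMk_nhds hs).mono_right (nhds_le_uniformity _)
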